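/- No subgroup of G of order 2 or of order 6 contains an element g with ind(g) = 2; consequently, every proper subgroup H of G that contains an element of index 2 has order 3 or 9 and is contained in N = ⟨(1 2 3), (4 5 6)⟩. -/

import Mathlib

/-- The 3-cycle (1 2 3) of S₆, acting on `Fin 6` as the cycle 0 → 1 → 2 → 0. -/
def g₁ : Equiv.Perm (Fin 6) := List.formPerm [0, 1, 2]

/-- The 3-cycle (4 5 6) of S₆, acting on `Fin 6` as the cycle 3 → 4 → 5 → 3. -/
def g₂ : Equiv.Perm (Fin 6) := List.formPerm [3, 4, 5]

/-- The involution (1 4)(2 5)(3 6) of S₆. -/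
def g₃ : Equiv.Perm (Fin 6) :=
  Equiv.swap 0 3 * Equiv.swap 1 4 * Equiv.swap 2 5

/-- Klüners' group `G = C₃ ≀ C₂ ≤ S₆`, generated by (1 2 3), (4 5 6) and
(1 4)(2 5)(3 6). -/
def G : Subgroup (Equiv.Perm (Fin 6)) := Subgroup.closure {g₁, g₂, g₃}

/-- The subgroup N = ⟨(1 2 3), (4 5 6)⟩, the unique Sylow 3-subgroup of G. -/
def N : Subgroup (Equiv.Perm (Fin 6)) := Subgroup.closure {g₁, g₂}

/-- The index `ind g = 6 - #{orbits of ⟨g⟩ on {1,…,6}}` of a permutation in S₆. -/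
noncomputable def ind (g : Equiv.Perm (Fin 6)) : ℕ :=
  6 - Nat.card (MulAction.orbitRel.Quotient (Subgroup.zpowers g) (Fin 6))

/-- The orbit of `x` under a permutation `g` with `g ^ 6 = 1`, as a finite set. -/
def orbitFinset (g : Equiv.Perm (Fin 6)) (x : Fin 6) : Finset (Fin 6) :=
  Finset.univ.image fun n : Fin 6 => (g ^ (n : ℕ)) x

theorem coe_orbitFinset {g : Equiv.Perm (Fin 6)} (hg : g ^ 6 = 1) (x : Fin 6) :
    (orbitFinset g x : Set (Fin 6)) = MulAction.orbit (Subgroup.zpowers g) x := by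
  ext y
  simp only [orbitFinset, Finset.coe_image, Finset.coe_univ, Set.image_univ, Set.mem_range,
    MulAction.mem_orbit_iff]
  constructor
  · rintro ⟨n, rfl⟩
    exact ⟨⟨g ^ (n : ℕ), Subgroup.npow_mem_zpowers g n⟩, rfl⟩
  · rintro ⟨⟨h, hh⟩, rfl⟩
    obtain ⟨k, rfl⟩ := mem_powers_iff_mem_zpowers.2 hh
    refine ⟨⟨k % 6, Nat.mod_lt _ (by norm_num)⟩, ?_⟩
    change (g ^ (k % 6)) x = (g ^ k) x
    rw [← pow_mod_orderOf g (k % 6), Nat.mod_mod_of_dvd _ (orderOf_dvd_of_pow_eq_one hg),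
      pow_mod_orderOf]

theorem ind_eq_of_pow_six_eq_one {g : Equiv.Perm (Fin 6)} (hg : g ^ 6 = 1) :
    ind g = 6 - (Finset.univ.image (orbitFinset g)).card := by
  have h : MulAction.orbitRel (Subgroup.zpowers g) (Fin 6) = Setoid.ker (orbitFinset g) := by
    ext x y
    rw [MulAction.orbitRel_apply, ← MulAction.orbit_eq_iff, ← coe_orbitFinset hg,
      ← coe_orbitFinset hg, Finset.coe_inj, Setoid.ker_def]
  rw [ind, MulAction.orbitRel.Quotient, h,
    Nat.card_congr (Setoid.quotientKerEquivRange (orbitFinset g)),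
    Nat.card_coe_set_eq, ← Set.ncard_coe_finset, Finset.coe_image, Finset.coe_univ, Set.image_univ]

theorem g₁_mem_N : g₁ ∈ N := Subgroup.subset_closure (by simp)

theorem g₂_mem_N : g₂ ∈ N := Subgroup.subset_closure (by simp)

theorem N_le_iff {H : Subgroup (Equiv.Perm (Fin 6))} : N ≤ H ↔ g₁ ∈ H ∧ g₂ ∈ H := by
  simp [N, Subgroup.closure_le, Set.insert_subset_iff]

theorem N_le_G : N ≤ G :=
  Subgroup.closure_mono (Set.insert_subset_insert (by simp))

theorem mem_N_iff {g : Equiv.Perm (Fin 6)} :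
    g ∈ N ↔ ∃ a b : Fin 3, g₁ ^ (a : ℕ) * g₂ ^ (b : ℕ) = g := by
  constructor
  · intro hg
    induction hg using Subgroup.closure_induction_right with
    | one => exact ⟨0, 0, rfl⟩
    | mul_right x hx y hy ih =>
      obtain ⟨a, b, rfl⟩ := ih
      clear hx
      rcases hy with rfl | rfl <;> revert a b <;> decide +kernel
    | mul_inv_cancel x hx y hy ih =>
      obtain ⟨a, b, rfl⟩ := ih
      clear hx
      rcases hy with rfl | rfl <;> revert a b <;> decide +kernel
  · rintro ⟨a, b, rfl⟩
    exact mul_mem (pow_mem g₁_mem_N _) (pow_mem g₂_mem_N _)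

theorem card_N : Nat.card N = 9 := by
  have h : (N : Set (Equiv.Perm (Fin 6))) =
      Set.range fun p : Fin 3 × Fin 3 => g₁ ^ (p.1 : ℕ) * g₂ ^ (p.2 : ℕ) := by
    ext g
    simp [mem_N_iff]
  have hinj : Function.Injective
      fun p : Fin 3 × Fin 3 => g₁ ^ (p.1 : ℕ) * g₂ ^ (p.2 : ℕ) := by decide
  rw [← SetLike.coe_sort_coe, h, Nat.card_range_of_injective hinj]
  simp

theorem exists_mul_g₃_pow_of_mem_G {g : Equiv.Perm (Fin 6)} (hg : g ∈ G) :
    ∃ (a b : Fin 3) (c : Fin 2), g₁ ^ (a : ℕ) * g₂ ^ (b : ℕ) * g₃ ^ (c : ℕ) = g := by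
  induction hg using Subgroup.closure_induction_right with
  | one => exact ⟨0, 0, 0, rfl⟩
  | mul_right x hx y hy ih =>
    obtain ⟨a, b, c, rfl⟩ := ih
    clear hx
    rcases hy with rfl | rfl | rfl <;> revert a b c <;> decide +kernel
  | mul_inv_cancel x hx y hy ih =>
    obtain ⟨a, b, c, rfl⟩ := ih
    clear hx
    rcases hy with rfl | rfl | rfl <;> revert a b c <;> decide +kernel

theorem eq_of_mem_G_of_ind_eq_two {g : Equiv.Perm (Fin 6)} (hg : g ∈ G) (h : ind g = 2) :
    g = g₁ ∨ g = g₁⁻¹ ∨ g = g₂ ∨ g = g₂⁻¹ := by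
  obtain ⟨a, b, c, rfl⟩ := exists_mul_g₃_pow_of_mem_G hg
  have h6 : ∀ (a b : Fin 3) (c : Fin 2),
      (g₁ ^ (a : ℕ) * g₂ ^ (b : ℕ) * g₃ ^ (c : ℕ)) ^ 6 = 1 := by decide +kernel
  rw [ind_eq_of_pow_six_eq_one (h6 a b c)] at h
  clear hg
  revert a b c
  decide +kernel

theorem mem_N_or_mul_g₃_mem {g : Equiv.Perm (Fin 6)} (hg : g ∈ G) :
    g ∈ N ∨ ∃ n ∈ N, n * g₃ = g := by
  obtain ⟨a, b, c, rfl⟩ := exists_mul_g₃_pow_of_mem_G hg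
  have hn : g₁ ^ (a : ℕ) * g₂ ^ (b : ℕ) ∈ N := mem_N_iff.2 ⟨a, b, rfl⟩
  fin_cases c
  · left; simpa using hn
  · right; exact ⟨_, hn, by simp⟩

theorem conj_of_notMem_N {g : Equiv.Perm (Fin 6)} (hg : g ∈ G) (hN : g ∉ N) :
    g * g₁ * g⁻¹ = g₂ ∧ g * g₂ * g⁻¹ = g₁ := by
  obtain ⟨n, hn, rfl⟩ := (mem_N_or_mul_g₃_mem hg).resolve_left hN
  obtain ⟨a, b, rfl⟩ := mem_N_iff.1 hn
  clear hg hN hn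
  revert a b
  decide +kernel

/-- A subgroup of `G` that contains an element of index 2 and is not contained in `N` is `G`. -/
theorem eq_G_of_not_le_N {H : Subgroup (Equiv.Perm (Fin 6))} (hG : H ≤ G) (hN : ¬ H ≤ N)
    {g : Equiv.Perm (Fin 6)} (hg : g ∈ H) (h : ind g = 2) : H = G := by
  obtain ⟨x, hx, hxN⟩ := SetLike.not_le_iff_exists.1 hN
  obtain ⟨h₁₂, h₂₁⟩ := conj_of_notMem_N (hG hx) hxN
  have key : g₁ ∈ H ∨ g₂ ∈ H := by
    rcases eq_of_mem_G_of_ind_eq_two (hG hg) h with rfl | rfl | rfl | rfl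
    · exact .inl hg
    · exact .inl (inv_mem_iff.1 hg)
    · exact .inr hg
    · exact .inr (inv_mem_iff.1 hg)
  have hNH : N ≤ H := by
    rw [N_le_iff]
    rcases key with h₁ | h₂
    · exact ⟨h₁, h₁₂ ▸ mul_mem (mul_mem hx h₁) (inv_mem hx)⟩
    · exact ⟨h₂₁ ▸ mul_mem (mul_mem hx h₂) (inv_mem hx), h₂⟩
  obtain ⟨n, hn, rfl⟩ := (mem_N_or_mul_g₃_mem (hG hx)).resolve_left hxN
  have h₃ : g₃ ∈ H := (H.mul_mem_cancel_left (hNH hn)).1 hx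
  refine le_antisymm hG ?_
  rw [G, Subgroup.closure_le]
  rintro y (rfl | rfl | rfl)
  exacts [hNH g₁_mem_N, hNH g₂_mem_N, h₃]

theorem card_eq_three_or_nine {H : Subgroup (Equiv.Perm (Fin 6))} (hG : H ≤ G) (hN : H ≤ N)
    {g : Equiv.Perm (Fin 6)} (hg : g ∈ H) (h : ind g = 2) :
    Nat.card H = 3 ∨ Nat.card H = 9 := by
  have hdvd : Nat.card H ∣ 3 ^ 2 := (Subgroup.card_dvd_of_le hN).trans card_N.dvd
  obtain ⟨k, hk, hcard⟩ := (Nat.dvd_prime_pow Nat.prime_three).1 hdvd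
  interval_cases k
  · rw [pow_zero, Subgroup.card_eq_one] at hcard
    subst hcard
    rw [Subgroup.mem_bot] at hg
    subst hg
    exact absurd (eq_of_mem_G_of_ind_eq_two (one_mem G) h) (by decide)
  · exact .inl hcard
  · exact .inr hcard

/-- No subgroup of Klüners' group G of order 2 or of order 6 contains an
element of index 2; consequently every proper subgroup of G containing an
element of index 2 has order 3 or 9 and is contained in
N = ⟨(1 2 3), (4 5 6)⟩. -/
theorem proper_subgroups_with_index_two_elements :
    (∀ H : Subgroup (Equiv.Perm (Fin 6)), H ≤ G →
      (Nat.card H = 2 ∨ Nat.card H = 6) → ∀ g ∈ H, ind g ≠ 2) ∧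
    (∀ H : Subgroup (Equiv.Perm (Fin 6)), H ≤ G → H ≠ G →
      (∃ g ∈ H, ind g = 2) → (Nat.card H = 3 ∨ Nat.card H = 9) ∧ H ≤ N) := by
  have hproper : ∀ H : Subgroup (Equiv.Perm (Fin 6)), H ≤ G → H ≠ G →
      (∃ g ∈ H, ind g = 2) → (Nat.card H = 3 ∨ Nat.card H = 9) ∧ H ≤ N := by
    rintro H hG hne ⟨g, hg, h⟩
    have hN : H ≤ N := by
      by_contra hN
      exact hne (eq_G_of_not_le_N hG hN hg h)
    exact ⟨card_eq_three_or_nine hG hN hg h, hN⟩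
  refine ⟨fun H hG hcard g hg h => ?_, hproper⟩
  have hne : H ≠ G := by
    rintro rfl
    have hdvd : 9 ∣ Nat.card G := card_N.symm.dvd.trans (Subgroup.card_dvd_of_le N_le_G)
    omega
  have := (hproper H hG hne ⟨g, hg, h⟩).1
  omega
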